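/- arXiv:0805.2569 — 2 statements merged into one kernel-verified Lean document; each statement's English description precedes it below -/
import Mathlib

section
/- (Gauss) Define f : (0,1) → ℝ by f(s) = ∫₀¹ dt/√(t(1−t)(1−st)) (a period of the elliptic curve y² = x(x−1)(x−s)). Then f is twice differentiable on (0,1) and satisfies the hypergeometric differential equation with parameters (1/2, 1/2, 1): for every s ∈ (0,1), s(1−s)·f''(s) + (1−2s)·f'(s) − (1/4)·f(s) = 0. -/
open intervalIntegral

/-- Up to a constant, the `k`-th derivative in `s` of `1 / √(t(1-t)(1-st))`. -/
noncomputable def periodIntegrand (k : ℕ) (s t : ℝ) : ℝ :=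
  (Real.sqrt (t * (1 - t)))⁻¹ * (t ^ k * (Real.sqrt (1 - s * t))⁻¹ ^ (2 * k + 1))

lemma measurable_periodIntegrand (k : ℕ) (s : ℝ) : Measurable (periodIntegrand k s) := by
  unfold periodIntegrand
  fun_prop

lemma intervalIntegrable_inv_sqrt_mul_one_sub :
    IntervalIntegrable (fun t : ℝ => (Real.sqrt (t * (1 - t)))⁻¹) MeasureTheory.volume 0 1 := by
  refine intervalIntegral.intervalIntegrable_deriv_of_nonneg
    (g := fun t => Real.arcsin (2 * t - 1)) (by fun_prop) ?_ ?_
  · intro t ht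
    simp only [zero_le_one, min_eq_left, max_eq_right] at ht
    have h := (Real.hasDerivAt_arcsin (x := 2 * t - 1) (by linarith [ht.1])
      (by linarith [ht.2])).comp t
      (((hasDerivAt_id t).const_mul 2).sub_const 1)
    refine h.congr_deriv ?_
    have h4 : 1 - (2 * t - 1) ^ 2 = 2 ^ 2 * (t * (1 - t)) := by ring
    rw [h4, Real.sqrt_mul (by norm_num), Real.sqrt_sq (by norm_num)]
    have : 0 < Real.sqrt (t * (1 - t)) := Real.sqrt_pos.2 (mul_pos ht.1 (by linarith [ht.2]))
    field_simp
  · intro t _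
    positivity

lemma one_sub_lt_one_sub_mul {r s t : ℝ} (hs : s ∈ Set.Ioo 0 r)
    (ht : t ∈ Set.Ioc (0 : ℝ) 1) : 1 - r < 1 - s * t := by
  nlinarith [hs.1, hs.2, ht.1, ht.2]

lemma norm_periodIntegrand_le (k : ℕ) {r s t : ℝ} (hr : r < 1) (hs : s ∈ Set.Ioo 0 r)
    (ht : t ∈ Set.Ioc (0 : ℝ) 1) :
    ‖periodIntegrand k s t‖ ≤
      (Real.sqrt (t * (1 - t)))⁻¹ * (Real.sqrt (1 - r))⁻¹ ^ (2 * k + 1) := by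
  have h0 : 0 < Real.sqrt (1 - r) := Real.sqrt_pos.2 (by linarith)
  have h1 := one_sub_lt_one_sub_mul hs ht
  have ht0 := ht.1.le
  have htk : t ^ k ≤ 1 := pow_le_one₀ ht0 ht.2
  unfold periodIntegrand
  rw [Real.norm_of_nonneg (by positivity)]
  refine mul_le_mul_of_nonneg_left ?_ (by positivity)
  calc t ^ k * (Real.sqrt (1 - s * t))⁻¹ ^ (2 * k + 1)
      ≤ 1 * (Real.sqrt (1 - s * t))⁻¹ ^ (2 * k + 1) := by gcongr
    _ ≤ (Real.sqrt (1 - r))⁻¹ ^ (2 * k + 1) := by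
      rw [one_mul]
      gcongr

lemma hasDerivAt_periodIntegrand (k : ℕ) {s t : ℝ} (h : 0 < 1 - s * t) :
    HasDerivAt (fun x => periodIntegrand k x t)
      ((2 * k + 1) / 2 * periodIntegrand (k + 1) s t) s := by
  have h0 : 0 < Real.sqrt (1 - s * t) := Real.sqrt_pos.2 h
  have hd := ((((((hasDerivAt_id s).mul_const t).const_sub 1).sqrt h.ne').fun_inv h0.ne').fun_pow
    (2 * k + 1)).const_mul (t ^ k) |>.const_mul (Real.sqrt (t * (1 - t)))⁻¹
  refine hd.congr_deriv ?_
  unfold periodIntegrand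
  simp only [id, Nat.add_sub_cancel]
  push_cast
  field_simp
  ring

lemma intervalIntegrable_periodIntegrand (k : ℕ) {s : ℝ} (hs : s ∈ Set.Ioo (0 : ℝ) 1) :
    IntervalIntegrable (periodIntegrand k s) MeasureTheory.volume 0 1 := by
  have hr : (1 + s) / 2 < 1 := by linarith [hs.2]
  refine (intervalIntegrable_inv_sqrt_mul_one_sub.mul_const
    ((Real.sqrt (1 - (1 + s) / 2))⁻¹ ^ (2 * k + 1))).mono_fun'
    (measurable_periodIntegrand k s).aestronglyMeasurable ?_
  rw [Set.uIoc_of_le zero_le_one]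
  filter_upwards [MeasureTheory.ae_restrict_mem measurableSet_Ioc] with t ht
  exact norm_periodIntegrand_le k hr ⟨hs.1, by linarith [hs.2]⟩ ht

lemma hasDerivAt_integral_periodIntegrand (k : ℕ) {s : ℝ} (hs : s ∈ Set.Ioo (0 : ℝ) 1) :
    HasDerivAt (fun x => ∫ t in (0 : ℝ)..1, periodIntegrand k x t)
      ((2 * k + 1) / 2 * ∫ t in (0 : ℝ)..1, periodIntegrand (k + 1) s t) s := by
  have hr : (1 + s) / 2 < 1 := by linarith [hs.2]
  have h := intervalIntegral.hasDerivAt_integral_of_dominated_loc_of_deriv_le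
    (μ := MeasureTheory.volume) (a := 0) (b := 1)
    (F := periodIntegrand k)
    (F' := fun x t => (2 * k + 1) / 2 * periodIntegrand (k + 1) x t)
    (bound := fun t => (2 * k + 1) / 2 * ((Real.sqrt (t * (1 - t)))⁻¹ *
      (Real.sqrt (1 - (1 + s) / 2))⁻¹ ^ (2 * (k + 1) + 1)))
    (Ioo_mem_nhds hs.1 (by linarith [hs.2] : s < (1 + s) / 2))
    (.of_forall fun x => (measurable_periodIntegrand k x).aestronglyMeasurable)
    (intervalIntegrable_periodIntegrand k hs)
    ((measurable_periodIntegrand (k + 1) s).const_mul _).aestronglyMeasurable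
    (.of_forall fun t ht x hx => ?_)
    ((intervalIntegrable_inv_sqrt_mul_one_sub.mul_const _).const_mul _)
    (.of_forall fun t ht x hx => ?_)
  · simpa only [intervalIntegral.integral_const_mul] using h.2
  · rw [Set.uIoc_of_le zero_le_one] at ht
    rw [norm_mul, Real.norm_of_nonneg (by positivity)]
    exact mul_le_mul_of_nonneg_left (norm_periodIntegrand_le (k + 1) hr hx ht) (by positivity)
  · rw [Set.uIoc_of_le zero_le_one] at ht
    exact hasDerivAt_periodIntegrand k (by linarith [one_sub_lt_one_sub_mul hx ht])

lemma hasDerivAt_periodIntegrand_primitive {s t : ℝ} (hs : s ∈ Set.Ioo (0 : ℝ) 1)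
    (ht : t ∈ Set.Ioo (0 : ℝ) 1) :
    HasDerivAt (fun t => -(1 / 2) * (Real.sqrt (t * (1 - t)) * (Real.sqrt (1 - s * t))⁻¹ ^ 3))
      (s * (1 - s) * (3 / 4 * periodIntegrand 2 s t) +
        (1 - 2 * s) * (1 / 2 * periodIntegrand 1 s t) - 1 / 4 * periodIntegrand 0 s t) t := by
  have hu : 0 < 1 - s * t := by nlinarith [hs.1, hs.2, ht.1, ht.2]
  have hw : 0 < t * (1 - t) := mul_pos ht.1 (by linarith [ht.2])
  have hu0 : 0 < Real.sqrt (1 - s * t) := Real.sqrt_pos.2 hu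
  have hw0 : 0 < Real.sqrt (t * (1 - t)) := Real.sqrt_pos.2 hw
  have hd := ((((hasDerivAt_id t).fun_mul ((hasDerivAt_id t).const_sub 1)).sqrt hw.ne').fun_mul
    ((((((hasDerivAt_id t).const_mul s).const_sub 1).sqrt hu.ne').fun_inv hu0.ne').fun_pow
      3)).const_mul (-(1 / 2))
  refine hd.congr_deriv ?_
  have hu2 := Real.sq_sqrt hu.le
  have hw2 := Real.sq_sqrt hw.le
  unfold periodIntegrand
  simp only [id]
  generalize Real.sqrt (1 - s * t) = u at *
  generalize Real.sqrt (t * (1 - t)) = w at *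
  norm_num only [inv_pow, pow_zero, pow_one]
  field_simp
  rw [hw2]
  simp only [show u ^ 4 = (u ^ 2) ^ 2 by ring, hu2]
  ring

lemma integral_periodIntegrand_combination {s : ℝ} (hs : s ∈ Set.Ioo (0 : ℝ) 1) :
    s * (1 - s) * (3 / 4 * ∫ t in (0 : ℝ)..1, periodIntegrand 2 s t) +
      (1 - 2 * s) * (1 / 2 * ∫ t in (0 : ℝ)..1, periodIntegrand 1 s t) -
      1 / 4 * (∫ t in (0 : ℝ)..1, periodIntegrand 0 s t) = 0 := by
  have h0 := (intervalIntegrable_periodIntegrand 0 hs).const_mul (1 / 4)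
  have h1 := ((intervalIntegrable_periodIntegrand 1 hs).const_mul (1 / 2)).const_mul (1 - 2 * s)
  have h2 := ((intervalIntegrable_periodIntegrand 2 hs).const_mul (3 / 4)).const_mul (s * (1 - s))
  have hcont : ContinuousOn
      (fun t => -(1 / 2) * (Real.sqrt (t * (1 - t)) * (Real.sqrt (1 - s * t))⁻¹ ^ 3))
      (Set.Icc 0 1) := by
    have hinv : ContinuousOn (fun t => (Real.sqrt (1 - s * t))⁻¹) (Set.Icc 0 1) := by
      refine ContinuousOn.inv₀ (by fun_prop) fun t ht => (Real.sqrt_pos.2 ?_).ne'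
      nlinarith [hs.1, hs.2, ht.1, ht.2]
    fun_prop
  have h := intervalIntegral.integral_eq_sub_of_hasDerivAt_of_le zero_le_one hcont
    (fun t ht => hasDerivAt_periodIntegrand_primitive hs ht) ((h2.add h1).sub h0)
  rw [intervalIntegral.integral_sub (h2.add h1) h0, intervalIntegral.integral_add h2 h1] at h
  simpa only [intervalIntegral.integral_const_mul, mul_zero, sub_self, zero_mul, sub_zero,
    Real.sqrt_zero, mul_one] using h

lemma one_div_sqrt_eq_periodIntegrand {s t : ℝ} (ht : t ∈ Set.Icc (0 : ℝ) 1) :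
    1 / Real.sqrt (t * (1 - t) * (1 - s * t)) = periodIntegrand 0 s t := by
  have : 0 ≤ t * (1 - t) := mul_nonneg ht.1 (by linarith [ht.2])
  simp [periodIntegrand, Real.sqrt_mul this, mul_comm]

/-- (Gauss) The elliptic period `f(s) = ∫₀¹ dt / √(t(1-t)(1-st))` is twice
differentiable on `(0,1)` and satisfies the hypergeometric differential equation with
parameters `(1/2, 1/2, 1)`: `s(1-s) f''(s) + (1-2s) f'(s) - (1/4) f(s) = 0`. -/
theorem elliptic_period_hypergeometric_ode
    (f : ℝ → ℝ)
    (hf : ∀ s : ℝ, f s = ∫ t in (0 : ℝ)..1, 1 / Real.sqrt (t * (1 - t) * (1 - s * t))) :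
    ∀ s ∈ Set.Ioo (0 : ℝ) 1,
      DifferentiableAt ℝ f s ∧ DifferentiableAt ℝ (deriv f) s ∧
      s * (1 - s) * deriv (deriv f) s + (1 - 2 * s) * deriv f s - (1 / 4) * f s = 0 := by
  intro s hs
  have hf0 : f = fun x => ∫ t in (0 : ℝ)..1, periodIntegrand 0 x t := by
    funext x
    rw [hf x]
    refine intervalIntegral.integral_congr fun t ht => one_div_sqrt_eq_periodIntegrand ?_
    rwa [Set.uIcc_of_le zero_le_one] at ht
  have hd0 : ∀ x ∈ Set.Ioo (0 : ℝ) 1,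
      HasDerivAt f (1 / 2 * ∫ t in (0 : ℝ)..1, periodIntegrand 1 x t) x := fun x hx => by
    simpa [hf0] using hasDerivAt_integral_periodIntegrand 0 hx
  have hev : deriv f =ᶠ[nhds s] fun x => 1 / 2 * ∫ t in (0 : ℝ)..1, periodIntegrand 1 x t := by
    filter_upwards [Ioo_mem_nhds hs.1 hs.2] with x hx using (hd0 x hx).deriv
  have hd1 : HasDerivAt (deriv f) (3 / 4 * ∫ t in (0 : ℝ)..1, periodIntegrand 2 s t) s := by
    refine (((hasDerivAt_integral_periodIntegrand 1 hs).const_mul (1 / 2)).congr_deriv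
      ?_).congr_of_eventuallyEq hev
    norm_num
    ring
  refine ⟨(hd0 s hs).differentiableAt, hd1.differentiableAt, ?_⟩
  rw [hd1.deriv, (hd0 s hs).deriv, congrFun hf0 s]
  exact integral_periodIntegrand_combination hs
end

section
/- (Hermite–Lindemann) For every rational number q with q ≠ 0, q ≠ 1 and q ≠ −1, the complex logarithm log q is transcendental over ℚ. In particular, for rational q > 0 with q ≠ 1, the real number log q is transcendental. -/
open Polynomial in
/-- If `l • x` is integral, then `l ^ m` clears the denominators of every integer polynomial
expression of degree at most `m` in `x`. -/
theorem IsIntegral.pow_mul_aeval {R A : Type*} [CommRing R] [CommRing A] [Algebra R A]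
    {l : R} {x : A} (hx : IsIntegral R (l • x)) {g : R[X]} {m : ℕ} (hg : g.natDegree ≤ m) :
    IsIntegral R (l ^ m • aeval x g) := by
  rw [aeval_eq_sum_range' (Nat.lt_succ_of_le hg), Finset.smul_sum]
  refine IsIntegral.sum _ fun i hi ↦ ?_
  have hi : i ≤ m := Nat.lt_succ_iff.mp (Finset.mem_range.mp hi)
  have : l ^ m • g.coeff i • x ^ i = (l ^ (m - i) * g.coeff i) • (l • x) ^ i := by
    rw [_root_.smul_pow, smul_smul, smul_smul, mul_right_comm, ← pow_add, Nat.sub_add_cancel hi]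
  rw [this]
  exact (hx.pow i).smul _

/-- Finitely many nonzero algebraic numbers are roots of an integer polynomial with nonzero
constant term. -/
theorem exists_int_polynomial_eval_zero_ne_zero {ι : Type*} (s : Finset ι) (x : ι → ℂ)
    (hx : ∀ i ∈ s, IsAlgebraic ℤ (x i)) (hx0 : ∀ i ∈ s, x i ≠ 0) :
    ∃ f : Polynomial ℤ, f.eval 0 ≠ 0 ∧ ∀ i ∈ s, Polynomial.aeval (x i) f = 0 := by
  choose! f hf hfx using fun i hi ↦
    (hx i hi).exists_nonzero_coeff_and_aeval_eq_zero (mem_nonZeroDivisors_of_ne_zero (hx0 i hi))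
  refine ⟨∏ i ∈ s, f i, ?_, fun i hi ↦ ?_⟩
  · rw [Polynomial.eval_prod, Finset.prod_ne_zero_iff]
    intro i hi
    rw [← Polynomial.coeff_zero_eq_eval_zero]
    exact hf i hi
  · rw [map_prod]
    exact Finset.prod_eq_zero hi (hfx i hi)

theorem exists_nat_forall_mul_pow_div_factorial_pred_lt_one (A B : ℝ) :
    ∃ N : ℕ, ∀ p ≥ N, A * (B ^ p / (p - 1).factorial) < 1 := by
  have h := ((FloorSemiring.tendsto_pow_div_factorial_atTop B).const_mul (A * B)).comp
    (Filter.tendsto_sub_atTop_nat 1)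
  rw [mul_zero] at h
  obtain ⟨N, hN⟩ := Filter.eventually_atTop.mp (h.eventually_lt_const one_pos)
  refine ⟨N + 1, fun p hp ↦ ?_⟩
  have := hN p (by omega)
  obtain ⟨k, rfl⟩ : ∃ k, p = k + 1 := ⟨p - 1, by omega⟩
  simp only [Function.comp_apply, Nat.add_sub_cancel] at this ⊢
  calc _ = A * B * (B ^ k / k.factorial) := by ring
    _ < 1 := this

/-- If an integer linear combination of exponentials of algebraic numbers vanishes, and the
corresponding combinations of values of integer polynomials are all rational, then the total
coefficient of `exp 0` vanishes. -/
theorem sum_coeff_exp_zero_eq_zero {ι : Type*} (s : Finset ι) (β : ι → ℂ) (c : ι → ℤ)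
    (hβ : ∀ i ∈ s, IsAlgebraic ℤ (β i))
    (hrat : ∀ g : Polynomial ℤ,
      ∑ i ∈ s, (c i : ℂ) * Polynomial.aeval (β i) g ∈ Set.range (algebraMap ℚ ℂ))
    (hexp : ∑ i ∈ s, (c i : ℂ) * Complex.exp (β i) = 0) :
    ∑ i ∈ s with β i = 0, c i = 0 := by
  by_contra hK
  set K := ∑ i ∈ s with β i = 0, c i with hKdef
  set t := s.filter (fun i ↦ ¬ β i = 0)
  have hts : ∀ i ∈ t, i ∈ s := fun i hi ↦ (Finset.mem_filter.mp hi).1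
  have ht0 : ∀ i ∈ t, β i ≠ 0 := fun i hi ↦ (Finset.mem_filter.mp hi).2
  obtain ⟨f, hf0, hf⟩ := exists_int_polynomial_eval_zero_ne_zero t β
    (fun i hi ↦ hβ i (hts i hi)) ht0
  have hf_ne : f ≠ 0 := by rintro rfl; simp at hf0
  obtain ⟨C, hC⟩ := LindemannWeierstrass.exp_polynomial_approx f hf0
  obtain ⟨l, hl0, hl⟩ : ∃ l : ℤ, l ≠ 0 ∧ ∀ i ∈ t, IsIntegral ℤ (l • β i) := by
    choose! r hr hri using fun i hi ↦ (hβ i (hts i hi)).exists_integral_multiple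
    classical
    refine ⟨∏ i ∈ t, r i, Finset.prod_ne_zero_iff.mpr hr, fun i hi ↦ ?_⟩
    rw [← Finset.prod_erase_mul _ _ hi, mul_smul]
    exact (hri i hi).smul _
  set D := f.natDegree
  obtain ⟨N, hN⟩ := exists_nat_forall_mul_pow_div_factorial_pred_lt_one
    (∑ i ∈ t, |(c i : ℝ)|) (|(l : ℝ)| ^ D * C)
  obtain ⟨p, hpN, hp⟩ := Nat.exists_infinite_primes
    (N + (f.eval 0).natAbs + 1 + l.natAbs + K.natAbs)
  obtain ⟨n, hpn, g, hgdeg, hg⟩ := hC p (by omega) hp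
  have hsplit (F : ℂ → ℂ) :
      ∑ i ∈ s, (c i : ℂ) * F (β i) = K * F 0 + ∑ i ∈ t, (c i : ℂ) * F (β i) := by
    rw [← Finset.sum_filter_add_sum_filter_not s (fun i ↦ β i = 0), hKdef]
    push_cast
    rw [Finset.sum_mul]
    congr 1
    exact Finset.sum_congr rfl fun i hi ↦ by rw [(Finset.mem_filter.mp hi).2]
  obtain ⟨M, hM⟩ : ∃ M : ℤ,
      (M : ℂ) = (l : ℂ) ^ (p * D) * ∑ i ∈ t, (c i : ℂ) * Polynomial.aeval (β i) g := by
    have hint : IsIntegral ℤ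
        ((l : ℂ) ^ (p * D) * ∑ i ∈ t, (c i : ℂ) * Polynomial.aeval (β i) g) := by
      rw [Finset.mul_sum]
      refine IsIntegral.sum _ fun i hi ↦ ?_
      have := ((hl i hi).pow_mul_aeval (hgdeg.trans (Nat.sub_le _ _))).smul (c i)
      convert! this using 1
      simp only [zsmul_eq_mul, Int.cast_pow]
      ring
    obtain ⟨r, hr⟩ := hrat g
    rw [hsplit (fun x ↦ Polynomial.aeval x g)] at hr
    have hq : algebraMap ℚ ℂ ((l : ℚ) ^ (p * D) * (r - K * g.eval 0)) =
        (l : ℂ) ^ (p * D) * ∑ i ∈ t, (c i : ℂ) * Polynomial.aeval (β i) g := by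
      have h0 : Polynomial.aeval (0 : ℂ) g = (g.eval 0 : ℤ) := by
        simpa using Polynomial.aeval_algebraMap_apply_eq_algebraMap_eval (A := ℂ) (0 : ℤ) g
      rw [h0] at hr
      rw [map_mul, map_sub, hr]
      simp
    rw [← hq, isIntegral_algebraMap_iff (algebraMap ℚ ℂ).injective,
      IsIntegrallyClosed.isIntegral_iff] at hint
    obtain ⟨M, hM⟩ := hint
    exact ⟨M, by rw [← hq, ← hM]; simp⟩
  have hval : ((l ^ (p * D) * (n * K) + p * M : ℤ) : ℂ) = -((l : ℂ) ^ (p * D) *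
      ∑ i ∈ t, (c i : ℂ) * (n • Complex.exp (β i) - p • Polynomial.aeval (β i) g)) := by
    have h := hsplit Complex.exp
    rw [hexp, Complex.exp_zero, mul_one] at h
    have h2 : ∑ i ∈ t, (c i : ℂ) * (n • Complex.exp (β i) - p • Polynomial.aeval (β i) g) =
        n * ∑ i ∈ t, (c i : ℂ) * Complex.exp (β i) -
          p * ∑ i ∈ t, (c i : ℂ) * Polynomial.aeval (β i) g := by
      rw [Finset.mul_sum, Finset.mul_sum, ← Finset.sum_sub_distrib]
      refine Finset.sum_congr rfl fun i _ ↦ ?_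
      simp only [zsmul_eq_mul, nsmul_eq_mul]
      ring
    rw [h2]
    push_cast
    rw [hM]
    linear_combination (-(l : ℂ) ^ (p * D) * n) * h
  have hlt : ‖((l ^ (p * D) * (n * K) + p * M : ℤ) : ℂ)‖ < 1 := by
    rw [hval, norm_neg, norm_mul, norm_pow, Complex.norm_intCast]
    refine lt_of_le_of_lt ?_ (hN p (by omega))
    calc _ ≤ |(l : ℝ)| ^ (p * D) * ∑ i ∈ t, |(c i : ℝ)| * (C ^ p / (p - 1).factorial) := by
          gcongr
          refine norm_sum_le_of_le _ fun i hi ↦ ?_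
          rw [norm_mul, Complex.norm_intCast]
          gcongr
          exact hg (Polynomial.mem_aroots.mpr ⟨hf_ne, hf i hi⟩)
      _ = _ := by
          rw [← Finset.sum_mul, mul_pow, ← pow_mul, mul_comm p D]
          ring
  rw [Complex.norm_intCast, ← Int.cast_abs, ← Int.cast_one, Int.cast_lt, Int.abs_lt_one_iff] at hlt
  have hdvd : (p : ℤ) ∣ l ^ (p * D) * (n * K) :=
    (dvd_add_left (dvd_mul_right (p : ℤ) M)).mp (hlt ▸ dvd_zero _)
  have hpZ := Nat.prime_iff_prime_int.mp hp
  have hlarge {m : ℤ} (hm0 : m ≠ 0) (hm : m.natAbs < p) : ¬ (p : ℤ) ∣ m := fun h ↦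
    (Nat.le_of_dvd (Int.natAbs_pos.mpr hm0) (Int.natCast_dvd.mp h)).not_gt hm
  rcases hpZ.dvd_or_dvd hdvd with h | h
  · exact hlarge hl0 (by omega) (hpZ.dvd_of_dvd_pow h)
  · rcases hpZ.dvd_or_dvd h with h | h
    · exact hpn h
    · exact hlarge hK (by omega) h

/-- Every algebraic number lies in a finite Galois extension of `ℚ` inside `ℂ`. -/
theorem exists_isGalois_mem_intermediateField {α : ℂ} (hα : IsAlgebraic ℚ α) :
    ∃ L : IntermediateField ℚ ℂ, FiniteDimensional ℚ L ∧ IsGalois ℚ L ∧ α ∈ L := by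
  have : Polynomial.IsSplittingField ℚ
      (IntermediateField.adjoin ℚ ((minpoly ℚ α).rootSet ℂ)) (minpoly ℚ α) :=
    IntermediateField.adjoin_rootSet_isSplittingField (IsAlgClosed.splits _)
  refine ⟨IntermediateField.adjoin ℚ ((minpoly ℚ α).rootSet ℂ),
    Polynomial.IsSplittingField.finiteDimensional _ (minpoly ℚ α),
    IsGalois.of_separable_splitting_field (p := minpoly ℚ α)
      (minpoly.irreducible hα.isIntegral).separable,
    IntermediateField.subset_adjoin _ _ ?_⟩
  exact Polynomial.mem_rootSet.mpr ⟨minpoly.ne_zero hα.isIntegral, minpoly.aeval ℚ α⟩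

open Pointwise in
/-- The exponential of an algebraic number is not a rational number whose denominator is divisible
by a prime. -/
theorem int_mul_exp_ne_int_of_prime_dvd {α : ℂ} (hα : IsAlgebraic ℚ α) {a b ℓ : ℤ}
    (hℓ : Prime ℓ) (hb : ℓ ∣ b) (ha : ¬ ℓ ∣ a) : (b : ℂ) * Complex.exp α ≠ a := by
  classical
  intro heq
  obtain ⟨L, hfin, hgal, hαL⟩ := exists_isGalois_mem_intermediateField hα
  set x : L := ⟨α, hαL⟩
  let γ : Finset Gal(L/ℚ) → L := fun S ↦ ∑ σ ∈ S, σ x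
  let c : Finset Gal(L/ℚ) → ℤ := fun S ↦ b ^ S.card * (-a) ^ (Finset.univ \ S).card
  have hsum := sum_coeff_exp_zero_eq_zero Finset.univ (fun S ↦ (γ S : ℂ)) c ?_ ?_ ?_
  · have hempty : (∅ : Finset Gal(L/ℚ)) ∈ Finset.univ.filter fun S ↦ (γ S : ℂ) = 0 := by
      simp [γ]
    rw [← Finset.add_sum_erase _ _ hempty] at hsum
    have hrest : ℓ ∣ ∑ S ∈ (Finset.univ.filter fun S ↦ (γ S : ℂ) = 0).erase ∅, c S := by
      refine Finset.dvd_sum fun S hS ↦ ?_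
      have hS : S.card ≠ 0 := Finset.card_ne_zero.mpr
        (Finset.nonempty_iff_ne_empty.mpr (Finset.ne_of_mem_erase hS))
      exact Dvd.dvd.mul_right (dvd_pow hb hS) _
    have hc : ℓ ∣ c ∅ := (dvd_add_left hrest).mp (hsum ▸ dvd_zero _)
    simp only [c, Finset.card_empty, pow_zero, one_mul] at hc
    exact ha ((dvd_neg).mp (hℓ.dvd_of_dvd_pow hc))
  · intro S _
    rw [IsFractionRing.isAlgebraic_iff ℤ ℚ ℂ]
    exact (Algebra.IsAlgebraic.isAlgebraic (R := ℚ) (γ S)).algebraMap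
  · intro g
    have hfix : ∑ S, (c S : L) * Polynomial.aeval (γ S) g ∈ Set.range (algebraMap ℚ L) := by
      rw [IsGalois.mem_range_algebraMap_iff_fixed]
      intro τ
      rw [map_sum]
      refine Fintype.sum_equiv (MulAction.toPerm τ) _ _ fun S ↦ ?_
      have hγ : τ (γ S) = γ (τ • S) := by
        simp only [γ, map_sum, Finset.smul_finset_def]
        rw [Finset.sum_image fun _ _ _ _ h ↦ smul_left_cancel τ h]
        rfl
      have hc : c (τ • S) = c S := by
        simp only [c, Finset.card_univ_sdiff, Finset.card_smul_finset]
      have hτ : τ (Polynomial.aeval (γ S) g) = Polynomial.aeval (τ (γ S)) g :=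
        (Polynomial.aeval_algHom_apply ((τ : L →ₐ[ℚ] L).restrictScalars ℤ) (γ S) g).symm
      rw [map_mul, map_intCast, hτ, MulAction.toPerm_apply, hγ, hc]
    obtain ⟨r, hr⟩ := hfix
    refine ⟨r, ?_⟩
    have := congrArg (algebraMap L ℂ) hr
    rw [← IsScalarTower.algebraMap_apply] at this
    rw [this, map_sum]
    refine Finset.sum_congr rfl fun S _ ↦ ?_
    rw [map_mul, map_intCast, ← Polynomial.aeval_algebraMap_apply]
    rfl
  · have hprod : ∏ σ : Gal(L/ℚ), ((b : ℂ) * Complex.exp (σ x : L) + -(a : ℂ)) = 0 := by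
      refine Finset.prod_eq_zero (Finset.mem_univ 1) ?_
      rw [AlgEquiv.one_apply, heq, add_neg_cancel]
    rw [Finset.prod_add, Finset.powerset_univ] at hprod
    rw [← hprod]
    refine Finset.sum_congr rfl fun S _ ↦ ?_
    rw [Finset.prod_mul_distrib, Finset.prod_const, Finset.prod_const, ← Complex.exp_sum]
    simp only [c, γ]
    push_cast
    ring

/-- The exponential of an algebraic number is never a rational number other than `1` and `-1`. -/
theorem exp_ne_ratCast_of_isAlgebraic {α : ℂ} (hα : IsAlgebraic ℚ α) {q : ℚ} (h1 : q ≠ 1)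
    (h_neg : q ≠ -1) : Complex.exp α ≠ q := by
  intro heq
  have hden : (q.den : ℂ) ≠ 0 := Nat.cast_ne_zero.mpr q.den_ne_zero
  have hmul : (q.den : ℂ) * Complex.exp α = q.num := by
    rw [heq, Rat.cast_def, mul_div_cancel₀ _ hden]
  have hcop {p : ℕ} (hp : p.Prime) (h : p ∣ q.num.natAbs) (h' : p ∣ q.den) : False :=
    Nat.not_coprime_of_dvd_of_dvd hp.one_lt h h' q.reduced
  by_cases hd : q.den = 1
  · have hn : q.num.natAbs ≠ 1 := fun h ↦ by
      rcases Int.natAbs_eq q.num with h' | h' <;> rw [h] at h'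
      · exact h1 (Rat.ext (by simpa using h') (by simpa using hd))
      · exact h_neg (Rat.ext (by simpa using h') (by simpa using hd))
    obtain ⟨p, hp, hpn⟩ := Nat.exists_prime_and_dvd hn
    refine int_mul_exp_ne_int_of_prime_dvd (a := q.den) hα.neg (Nat.prime_iff_prime_int.mp hp)
      (Int.natCast_dvd.mpr hpn)
      (fun h ↦ hcop hp hpn (Int.natCast_dvd_natCast.mp h)) ?_
    rw [← hmul, mul_assoc, ← Complex.exp_add, add_neg_cancel, Complex.exp_zero, mul_one]
    simp
  · obtain ⟨p, hp, hpd⟩ := Nat.exists_prime_and_dvd hd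
    exact int_mul_exp_ne_int_of_prime_dvd (b := q.den) hα (Nat.prime_iff_prime_int.mp hp)
      (Int.natCast_dvd_natCast.mpr hpd)
      (fun h ↦ hcop hp (Int.natCast_dvd.mp h) hpd) (by simpa using hmul)

/-- (Hermite–Lindemann) For every rational `q ∉ {-1, 0, 1}`, the complex logarithm
`log q` is transcendental over `ℚ`; in particular, for rational `q > 0` with `q ≠ 1`,
the real number `log q` is transcendental. -/
theorem log_rational_transcendental :
    (∀ q : ℚ, q ≠ 0 → q ≠ 1 → q ≠ -1 → Transcendental ℚ (Complex.log (q : ℂ))) ∧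
    (∀ q : ℚ, 0 < q → q ≠ 1 → Transcendental ℚ (Real.log (q : ℝ))) := by
  have hcomplex (q : ℚ) (h0 : q ≠ 0) (h1 : q ≠ 1) (h_neg : q ≠ -1) :
      Transcendental ℚ (Complex.log (q : ℂ)) := fun h ↦
    exp_ne_ratCast_of_isAlgebraic h h1 h_neg (Complex.exp_log (Rat.cast_ne_zero.mpr h0))
  refine ⟨hcomplex, fun q hq h1 ↦ ?_⟩
  rw [← transcendental_algebraMap_iff (A := ℂ) (algebraMap ℝ ℂ).injective,
    Complex.coe_algebraMap, Complex.ofReal_log (by exact_mod_cast hq.le), Complex.ofReal_ratCast]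
  exact hcomplex q hq.ne' h1 (by linarith)
end
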